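/- arXiv:2310.16098 — 4 statements merged into one kernel-verified Lean document; each statement's English description precedes it below -/
import Mathlib

section
/- Let ρ : (0,∞) → [0,∞) be continuous and integrable with finite first moment, and set F(w) := −2 ∫₀^∞ min(w,x) ρ(x) dx. Let f : (0,∞) → ℝ be twice continuously differentiable such that w ↦ F(w) f″(w) and w ↦ ρ(w) f(w) are integrable on (0,∞) and the boundary terms vanish: F(w) f′(w) − F′(w) f(w) → 0 as w → 0⁺ and as w → ∞ (where F′(w) = −2 ∫_w^∞ ρ(x) dx). Then ∫₀^∞ F(w) f″(w) dw = 2 ∫₀^∞ ρ(w) f(w) dw. -/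
open MeasureTheory Set Filter

/-- The tail integral of an integrable function continuous on `(0,∞)` is differentiable there. -/
lemma hasDerivAt_integral_Ioi_of_continuousOn {g : ℝ → ℝ} (hc : ContinuousOn g (Ioi 0))
    (hi : IntegrableOn g (Ioi 0)) {w : ℝ} (hw : 0 < w) :
    HasDerivAt (fun a => ∫ x in Ioi a, g x) (-g w) w := by
  have hint : IntervalIntegrable g volume 0 w :=
    (intervalIntegrable_iff_integrableOn_Ioc_of_le hw.le).2 (hi.mono_set Ioc_subset_Ioi_self)
  have hderiv := intervalIntegral.integral_hasDerivAt_right hint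
    (hc.stronglyMeasurableAtFilter isOpen_Ioi w hw) (hc.continuousAt (Ioi_mem_nhds hw))
  refine (hderiv.const_sub (∫ x in Ioi 0, g x)).congr_of_eventuallyEq ?_
  filter_upwards [Ioi_mem_nhds hw] with a ha
  rw [← intervalIntegral.integral_Ioi_sub_Ioi hi (le_of_lt ha)]
  ring

/-- Splitting `∫ min(w,x) ρ(x) dx` at `x = w`. -/
lemma integral_min_mul_eq {ρ : ℝ → ℝ} (hint : IntegrableOn ρ (Ioi 0))
    (hmom : IntegrableOn (fun x => x * ρ x) (Ioi 0)) {w : ℝ} (hw : 0 < w) :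
    ∫ x in Ioi (0 : ℝ), min w x * ρ x =
      (∫ x in Ioi (0 : ℝ), x * ρ x) - (∫ x in Ioi w, x * ρ x) + w * ∫ x in Ioi w, ρ x := by
  have hsub : Ioi w ⊆ Ioi (0 : ℝ) := Ioi_subset_Ioi hw.le
  have hlow : EqOn (fun x => x * ρ x) (fun x => min w x * ρ x) (Ioc 0 w) := fun x hx => by
    simp [min_eq_right hx.2]
  have hhigh : EqOn (fun x => w * ρ x) (fun x => min w x * ρ x) (Ioi w) := fun x hx => by
    simp [min_eq_left (mem_Ioi.1 hx).le]
  have hmomLow := hmom.mono_set (show Ioc 0 w ⊆ Ioi 0 from Ioc_subset_Ioi_self)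
  have hunion : Ioi (0 : ℝ) = Ioc 0 w ∪ Ioi w := (Ioc_union_Ioi_eq_Ioi hw.le).symm
  have hdisj : Disjoint (Ioc 0 w) (Ioi w) := Ioc_disjoint_Ioi le_rfl
  have hmin : ∫ x in Ioi (0 : ℝ), min w x * ρ x =
      (∫ x in Ioc 0 w, x * ρ x) + ∫ x in Ioi w, w * ρ x := by
    rw [hunion, setIntegral_union hdisj measurableSet_Ioi (hmomLow.congr_fun hlow measurableSet_Ioc)
      (IntegrableOn.congr_fun ((hint.mono_set hsub).const_mul w) hhigh measurableSet_Ioi),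
      setIntegral_congr_fun measurableSet_Ioc hlow, setIntegral_congr_fun measurableSet_Ioi hhigh]
  have hmoment : ∫ x in Ioi (0 : ℝ), x * ρ x =
      (∫ x in Ioc 0 w, x * ρ x) + ∫ x in Ioi w, x * ρ x := by
    rw [hunion, setIntegral_union hdisj measurableSet_Ioi hmomLow (hmom.mono_set hsub)]
  rw [hmin, hmoment, integral_const_mul]
  ring

/-- **Integration-by-parts identity for the Fréchet derivative of the Gini
coefficient.**  With `F(w) = −2 ∫₀^∞ min(w,x) ρ(x) dx` and `F'(w) = −2 ∫_w^∞ ρ(x) dx`,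
for `f` twice continuously differentiable on `(0,∞)` with `F f''` and `ρ f`
integrable and vanishing boundary terms `F f' − F' f → 0` at `0⁺` and at `∞`,
`∫₀^∞ F(w) f''(w) dw = 2 ∫₀^∞ ρ(w) f(w) dw`. -/
theorem gini_frechet_integration_by_parts
    (ρ : ℝ → ℝ)
    (hcont : ContinuousOn ρ (Ioi 0))
    (hnn : ∀ w ∈ Ioi (0 : ℝ), 0 ≤ ρ w)
    (hint : IntegrableOn ρ (Ioi 0))
    (hmom : IntegrableOn (fun x => x * ρ x) (Ioi 0))
    (F F' : ℝ → ℝ)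
    (hF : ∀ w, F w = -2 * ∫ x in Ioi (0 : ℝ), min w x * ρ x)
    (hF' : ∀ w, F' w = -2 * ∫ x in Ioi w, ρ x)
    (f : ℝ → ℝ)
    (hf : ContDiffOn ℝ 2 f (Ioi 0))
    (hint1 : IntegrableOn (fun w => F w * deriv (deriv f) w) (Ioi 0))
    (hint2 : IntegrableOn (fun w => ρ w * f w) (Ioi 0))
    (hbd0 : Tendsto (fun w => F w * deriv f w - F' w * f w) (nhdsWithin 0 (Ioi 0)) (nhds 0))
    (hbdtop : Tendsto (fun w => F w * deriv f w - F' w * f w) atTop (nhds 0)) :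
    (∫ w in Ioi (0 : ℝ), F w * deriv (deriv f) w)
      = 2 * ∫ w in Ioi (0 : ℝ), ρ w * f w := by
  have hderivF' : ∀ w ∈ Ioi (0 : ℝ), HasDerivAt F' (2 * ρ w) w := by
    intro w hw
    rw [funext hF']
    exact ((hasDerivAt_integral_Ioi_of_continuousOn hcont hint hw).const_mul (-2)).congr_deriv
      (by ring)
  have hderivF : ∀ w ∈ Ioi (0 : ℝ), HasDerivAt F (F' w) w := by
    intro w hw
    have htail := hasDerivAt_integral_Ioi_of_continuousOn hcont hint hw
    have hmoment := hasDerivAt_integral_Ioi_of_continuousOn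
      (continuousOn_id.mul hcont) hmom hw
    have hsplit := (((hmoment.const_sub (∫ x in Ioi (0 : ℝ), x * ρ x)).add
      ((hasDerivAt_id w).mul htail)).const_mul (-2)).congr_deriv
        (g' := F' w) (by rw [hF']; simp only [Pi.mul_apply, id]; ring)
    refine hsplit.congr_of_eventuallyEq ?_
    filter_upwards [Ioi_mem_nhds hw] with a ha
    rw [hF, integral_min_mul_eq hint hmom ha]
    simp
  have hf1 : ∀ w ∈ Ioi (0 : ℝ), HasDerivAt f (deriv f w) w := fun w hw =>
    ((hf.differentiableOn two_ne_zero).differentiableAt (Ioi_mem_nhds hw)).hasDerivAt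
  have hf2 : ∀ w ∈ Ioi (0 : ℝ), HasDerivAt (deriv f) (deriv (deriv f) w) w := fun w hw =>
    (((hf.deriv_of_isOpen (m := 1) isOpen_Ioi (by norm_num)).differentiableOn
      one_ne_zero).differentiableAt (Ioi_mem_nhds hw)).hasDerivAt
  have hbd : ∀ w ∈ Ioi (0 : ℝ), HasDerivAt (fun w => F w * deriv f w - F' w * f w)
      (F w * deriv (deriv f) w - 2 * (ρ w * f w)) w := fun w hw =>
    (((hderivF w hw).mul (hf2 w hw)).sub ((hderivF' w hw).mul (hf1 w hw))).congr_deriv (by ring)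
  have hzero := integral_Ioi_deriv_mul_eq_sub (v := fun _ => (1 : ℝ)) (v' := fun _ => 0)
    (a' := 0) (b' := 0) hbd (fun x _ => hasDerivAt_const x 1)
    ((hint1.sub (hint2.const_mul 2)).congr (by filter_upwards with x; simp))
    (by simpa [Pi.mul_def] using hbd0) (by simpa [Pi.mul_def] using hbdtop)
  simp only [mul_one, mul_zero, add_zero, sub_zero] at hzero
  rw [integral_sub hint1 (hint2.const_mul 2), integral_const_mul] at hzero
  linarith
end

section
/- Let γ > 0 and let ρ : (0,∞) → [0,∞) be measurable and integrable with ∫₀^∞ ρ(w) dw = 1, ∫₀^∞ w ρ(w) dw = 1, and ρ essentially bounded with essential supremum ‖ρ‖_∞. Then 2 ∫₀^∞ D[w,ρ] ρ(w)² dw ≤ γ ‖ρ‖_∞ (1 − G[ρ]), where G[ρ] = 1 − ∫₀^∞ ∫₀^∞ min(w,x) ρ(w) ρ(x) dx dw. -/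
open MeasureTheory Set

/-- The diffusion kernel of the modified Yard-Sale Model:
`κ(w,x) = min(w,x)²` if `min(w,x) < 1` and `κ(w,x) = min(w,x)` otherwise. -/
noncomputable def mysmKernel (w x : ℝ) : ℝ :=
  if min w x < 1 then (min w x) ^ 2 else min w x

lemma mysmKernel_nonneg {w x : ℝ} (hw : 0 < w) (hx : 0 < x) : 0 ≤ mysmKernel w x := by
  have := lt_min hw hx
  unfold mysmKernel
  split_ifs <;> positivity

lemma mysmKernel_le_min {w x : ℝ} (hw : 0 < w) (hx : 0 < x) : mysmKernel w x ≤ min w x := by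
  have := lt_min hw hx
  unfold mysmKernel
  split_ifs <;> nlinarith

lemma integrableOn_min_mul {ρ : ℝ → ℝ} (hmeas : Measurable ρ) (hint : IntegrableOn ρ (Ioi 0))
    {w : ℝ} (hw : 0 < w) : IntegrableOn (fun x => min w x * ρ x) (Ioi 0) := by
  refine Integrable.mono' (hint.norm.const_mul w) (by fun_prop) ?_
  filter_upwards [ae_restrict_mem measurableSet_Ioi] with x hx
  rw [norm_mul, Real.norm_of_nonneg (lt_min hw hx).le]
  gcongr
  exact min_le_left _ _

lemma integrableOn_integral_min_mul {ρ : ℝ → ℝ} (hmeas : Measurable ρ)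
    (hnn : ∀ w ∈ Ioi (0 : ℝ), 0 ≤ ρ w) (hint : IntegrableOn ρ (Ioi 0))
    (hmom : IntegrableOn (fun w => w * ρ w) (Ioi 0)) :
    IntegrableOn (fun w => (∫ x in Ioi (0 : ℝ), min w x * ρ x) * ρ w) (Ioi 0) := by
  have hsm : StronglyMeasurable fun w => ∫ x in Ioi (0 : ℝ), min w x * ρ x := by
    have : StronglyMeasurable (Function.uncurry fun w x : ℝ => min w x * ρ x) := by
      apply Measurable.stronglyMeasurable
      unfold Function.uncurry
      fun_prop
    exact this.integral_prod_right
  refine Integrable.mono' (hmom.const_mul (∫ x in Ioi (0 : ℝ), ρ x))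
    (hsm.measurable.mul hmeas).aestronglyMeasurable ?_
  filter_upwards [ae_restrict_mem measurableSet_Ioi] with w hw
  have hρw := hnn w hw
  have h0 : 0 ≤ ∫ x in Ioi (0 : ℝ), min w x * ρ x :=
    setIntegral_nonneg measurableSet_Ioi fun x hx => mul_nonneg (lt_min hw hx).le (hnn x hx)
  have h1 : ∫ x in Ioi (0 : ℝ), min w x * ρ x ≤ w * ∫ x in Ioi (0 : ℝ), ρ x := by
    rw [← integral_const_mul]
    exact setIntegral_mono_on (integrableOn_min_mul hmeas hint hw) (hint.const_mul w)
      measurableSet_Ioi fun x hx => mul_le_mul_of_nonneg_right (min_le_left _ _) (hnn x hx)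
  rw [Real.norm_of_nonneg (mul_nonneg h0 hρw)]
  nlinarith [mul_le_mul_of_nonneg_right h1 hρw]

/-- **Core estimate for the bounding inequality.**  For an essentially bounded
density `ρ` on `(0,∞)` with unit zeroth and first moments,
`2 ∫₀^∞ D[w,ρ] ρ(w)² dw ≤ γ ‖ρ‖_∞ (1 − G[ρ])`, where
`D[w,ρ] = (γ/2) ∫₀^∞ κ(w,x) ρ(x) dx` and
`G[ρ] = 1 − ∬ min(w,x) ρ(w) ρ(x)`. -/
theorem gini_rate_bound_modified_ysm
    (γ : ℝ) (hγ : 0 < γ)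
    (ρ : ℝ → ℝ)
    (hmeas : Measurable ρ)
    (hnn : ∀ w ∈ Ioi (0 : ℝ), 0 ≤ ρ w)
    (hint : IntegrableOn ρ (Ioi 0))
    (hmass : (∫ w in Ioi (0 : ℝ), ρ w) = 1)
    (hmean : (∫ w in Ioi (0 : ℝ), w * ρ w) = 1)
    (hbdd : eLpNorm ρ ⊤ (volume.restrict (Ioi 0)) ≠ ⊤)
    (D : ℝ → ℝ)
    (hD : ∀ w, D w = γ / 2 * ∫ x in Ioi (0 : ℝ), mysmKernel w x * ρ x)
    (G : ℝ)
    (hG : G = 1 - ∫ w in Ioi (0 : ℝ), ∫ x in Ioi (0 : ℝ), min w x * ρ w * ρ x) :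
    2 * ∫ w in Ioi (0 : ℝ), D w * ρ w ^ 2
      ≤ γ * (eLpNorm ρ ⊤ (volume.restrict (Ioi 0))).toReal * (1 - G) := by
  have hmom : IntegrableOn (fun w => w * ρ w) (Ioi 0) :=
    Integrable.of_integral_ne_zero (by rw [hmean]; exact one_ne_zero)
  set M := (eLpNorm ρ ⊤ (volume.restrict (Ioi 0))).toReal with hM
  have hle : ∀ᵐ w ∂volume.restrict (Ioi (0 : ℝ)), ρ w ≤ M := by
    filter_upwards [ae_le_eLpNormEssSup (f := ρ) (μ := volume.restrict (Ioi (0 : ℝ)))] with w hw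
    rw [← eLpNorm_exponent_top] at hw
    have := ENNReal.toReal_mono hbdd hw
    rw [toReal_enorm] at this
    exact (le_abs_self _).trans this
  have hinner : ∀ w, ∫ x in Ioi (0 : ℝ), min w x * ρ w * ρ x
      = (∫ x in Ioi (0 : ℝ), min w x * ρ x) * ρ w := fun w => by
    rw [← integral_mul_const]
    congr 1 with x
    ring
  have hkernel : ∀ w ∈ Ioi (0 : ℝ), 0 ≤ ∫ x in Ioi (0 : ℝ), mysmKernel w x * ρ x := fun w hw =>
    setIntegral_nonneg measurableSet_Ioi fun x hx =>
      mul_nonneg (mysmKernel_nonneg hw hx) (hnn x hx)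
  have hmono : ∫ w in Ioi (0 : ℝ), (∫ x in Ioi (0 : ℝ), mysmKernel w x * ρ x) * ρ w ^ 2
      ≤ ∫ w in Ioi (0 : ℝ), M * ((∫ x in Ioi (0 : ℝ), min w x * ρ x) * ρ w) := by
    refine integral_mono_of_nonneg ?_
      ((integrableOn_integral_min_mul hmeas hnn hint hmom).const_mul M) ?_
    · filter_upwards [ae_restrict_mem measurableSet_Ioi] with w hw
      exact mul_nonneg (hkernel w hw) (sq_nonneg _)
    · filter_upwards [ae_restrict_mem measurableSet_Ioi, hle] with w hw hwM
      have hρw := hnn w hw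
      have hcomp : ∫ x in Ioi (0 : ℝ), mysmKernel w x * ρ x
          ≤ ∫ x in Ioi (0 : ℝ), min w x * ρ x := by
        refine integral_mono_of_nonneg ?_ (integrableOn_min_mul hmeas hint hw) ?_
        · filter_upwards [ae_restrict_mem measurableSet_Ioi] with x hx
          exact mul_nonneg (mysmKernel_nonneg hw hx) (hnn x hx)
        · filter_upwards [ae_restrict_mem measurableSet_Ioi] with x hx
          exact mul_le_mul_of_nonneg_right (mysmKernel_le_min hw hx) (hnn x hx)
      calc (∫ x in Ioi (0 : ℝ), mysmKernel w x * ρ x) * ρ w ^ 2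
          ≤ (∫ x in Ioi (0 : ℝ), min w x * ρ x) * (M * ρ w) :=
            mul_le_mul hcomp (by nlinarith) (sq_nonneg _) ((hkernel w hw).trans hcomp)
        _ = M * ((∫ x in Ioi (0 : ℝ), min w x * ρ x) * ρ w) := by ring
  rw [integral_const_mul] at hmono
  have hlhs : 2 * ∫ w in Ioi (0 : ℝ), D w * ρ w ^ 2
      = γ * ∫ w in Ioi (0 : ℝ), (∫ x in Ioi (0 : ℝ), mysmKernel w x * ρ x) * ρ w ^ 2 := by
    rw [← integral_const_mul, ← integral_const_mul]
    congr 1 with w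
    rw [hD]
    ring
  rw [hlhs, hG, sub_sub_cancel, mul_assoc]
  simp only [hinner]
  exact mul_le_mul_of_nonneg_left hmono hγ.le
end

section
/- Let γ > 0, let φ̃ : (0,∞) × (0,∞) → [0,∞) be measurable with φ̃(w,x) ≤ min(w,x) and φ̃(w,x)² ≤ min(w,x) for all w, x > 0, and let ρ : (0,∞) → [0,∞) be measurable and integrable with ∫₀^∞ ρ(w) dw = 1, ∫₀^∞ w ρ(w) dw = 1, and ρ ∈ L^∞. Define D̃[w,ρ] := (γ/2) ∫₀^∞ φ̃(w,x)² ρ(x) dx. Then 0 ≤ 2 ∫₀^∞ D̃[w,ρ] ρ(w)² dw ≤ γ ‖ρ‖_∞ (1 − G[ρ]), where G[ρ] = 1 − ∫₀^∞ ∫₀^∞ min(w,x) ρ(w) ρ(x) dx dw. -/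
open MeasureTheory Set

/-- **Inequality production bounds for a general class of transaction kernels.**
If `φ̃(w,x) ≤ min(w,x)` and `φ̃(w,x)² ≤ min(w,x)` on `(0,∞)²`, then for any
essentially bounded density `ρ` with unit zeroth and first moments, the induced
rate of change of the Gini coefficient satisfies
`0 ≤ 2 ∫₀^∞ D̃[w,ρ] ρ(w)² dw ≤ γ ‖ρ‖_∞ (1 − G[ρ])`, where
`D̃[w,ρ] = (γ/2) ∫₀^∞ φ̃(w,x)² ρ(x) dx` and
`G[ρ] = 1 − ∬ min(w,x) ρ(w) ρ(x)`. -/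
theorem gini_rate_bound_general_kernel
    (γ : ℝ) (hγ : 0 < γ)
    (φ : ℝ → ℝ → ℝ)
    (hφmeas : Measurable (Function.uncurry φ))
    (hφnn : ∀ w ∈ Ioi (0 : ℝ), ∀ x ∈ Ioi (0 : ℝ), 0 ≤ φ w x)
    (hφ1 : ∀ w ∈ Ioi (0 : ℝ), ∀ x ∈ Ioi (0 : ℝ), φ w x ≤ min w x)
    (hφ2 : ∀ w ∈ Ioi (0 : ℝ), ∀ x ∈ Ioi (0 : ℝ), φ w x ^ 2 ≤ min w x)
    (ρ : ℝ → ℝ)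
    (hmeas : Measurable ρ)
    (hnn : ∀ w ∈ Ioi (0 : ℝ), 0 ≤ ρ w)
    (hint : IntegrableOn ρ (Ioi 0))
    (hmass : (∫ w in Ioi (0 : ℝ), ρ w) = 1)
    (hmean : (∫ w in Ioi (0 : ℝ), w * ρ w) = 1)
    (hbdd : eLpNorm ρ ⊤ (volume.restrict (Ioi 0)) ≠ ⊤)
    (D : ℝ → ℝ)
    (hD : ∀ w, D w = γ / 2 * ∫ x in Ioi (0 : ℝ), φ w x ^ 2 * ρ x)
    (G : ℝ)
    (hG : G = 1 - ∫ w in Ioi (0 : ℝ), ∫ x in Ioi (0 : ℝ), min w x * ρ w * ρ x) :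
    0 ≤ 2 * ∫ w in Ioi (0 : ℝ), D w * ρ w ^ 2 ∧
    2 * ∫ w in Ioi (0 : ℝ), D w * ρ w ^ 2
      ≤ γ * (eLpNorm ρ ⊤ (volume.restrict (Ioi 0))).toReal * (1 - G) := by
  set μ := volume.restrict (Ioi (0 : ℝ))
  set M := (eLpNorm ρ ⊤ μ).toReal
  have hpos : ∀ᵐ w ∂μ, w ∈ Ioi (0 : ℝ) := ae_restrict_mem measurableSet_Ioi
  have hρM : ∀ᵐ w ∂μ, ρ w ≤ M := by
    rw [eLpNorm_exponent_top] at hbdd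
    filter_upwards [ae_le_eLpNormEssSup (f := ρ) (μ := μ)] with w hw
    have h := ENNReal.toReal_mono hbdd hw
    rw [toReal_enorm, ← eLpNorm_exponent_top] at h
    exact (le_abs_self _).trans h
  have hmint : Integrable (fun w => w * ρ w) μ := by
    by_contra h
    rw [integral_undef h] at hmean
    exact zero_ne_one hmean
  have hminint : ∀ w ∈ Ioi (0 : ℝ), Integrable (fun x => min w x * ρ x) μ := by
    intro w hw
    refine hmint.mono' (by fun_prop) ?_
    filter_upwards [hpos] with x hx
    rw [Real.norm_of_nonneg (mul_nonneg (le_min hw.le hx.le) (hnn x hx))]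
    exact mul_le_mul_of_nonneg_right (min_le_right w x) (hnn x hx)
  have hDnn : ∀ w ∈ Ioi (0 : ℝ), 0 ≤ D w := by
    intro w _
    rw [hD]
    refine mul_nonneg (by positivity) (integral_nonneg_of_ae ?_)
    filter_upwards [hpos] with x hx
    exact mul_nonneg (sq_nonneg _) (hnn x hx)
  have hDle : ∀ w ∈ Ioi (0 : ℝ), D w ≤ γ / 2 * ∫ x, min w x * ρ x ∂μ := by
    intro w hw
    rw [hD]
    refine mul_le_mul_of_nonneg_left (integral_mono_of_nonneg ?_ (hminint w hw) ?_)
      (by positivity)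
    · filter_upwards [hpos] with x hx
      exact mul_nonneg (sq_nonneg _) (hnn x hx)
    · filter_upwards [hpos] with x hx
      exact mul_le_mul_of_nonneg_right (hφ2 w hw x hx) (hnn x hx)
  have hpull : ∀ w, ∫ x, min w x * ρ w * ρ x ∂μ = ρ w * ∫ x, min w x * ρ x ∂μ := by
    intro w
    rw [← integral_const_mul]
    congr 1 with x
    ring
  have hGint : Integrable (fun w => ∫ x, min w x * ρ w * ρ x ∂μ) μ := by
    refine hint.mono' ?_ ?_
    · have hsm : StronglyMeasurable (fun p : ℝ × ℝ => min p.1 p.2 * ρ p.1 * ρ p.2) :=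
        Measurable.stronglyMeasurable (by fun_prop)
      exact hsm.integral_prod_right.aestronglyMeasurable
    · filter_upwards [hpos] with w hw
      have h0 : 0 ≤ ∫ x, min w x * ρ x ∂μ := by
        refine integral_nonneg_of_ae ?_
        filter_upwards [hpos] with x hx
        exact mul_nonneg (le_min hw.le hx.le) (hnn x hx)
      have h1 : ∫ x, min w x * ρ x ∂μ ≤ 1 := by
        rw [← hmean]
        refine integral_mono_ae (hminint w hw) hmint ?_
        filter_upwards [hpos] with x hx
        exact mul_le_mul_of_nonneg_right (min_le_right w x) (hnn x hx)
      rw [hpull, Real.norm_of_nonneg (mul_nonneg (hnn w hw) h0)]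
      exact mul_le_of_le_one_right (hnn w hw) h1
  have hrate_nn : 0 ≤ᵐ[μ] fun w => D w * ρ w ^ 2 := by
    filter_upwards [hpos] with w hw
    exact mul_nonneg (hDnn w hw) (sq_nonneg _)
  refine ⟨mul_nonneg zero_le_two (integral_nonneg_of_ae hrate_nn), ?_⟩
  have hle : ∫ w, D w * ρ w ^ 2 ∂μ
      ≤ ∫ w, γ / 2 * M * ∫ x, min w x * ρ w * ρ x ∂μ ∂μ := by
    refine integral_mono_of_nonneg hrate_nn (hGint.const_mul _) ?_
    filter_upwards [hpos, hρM] with w hw hwM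
    have hw0 := hnn w hw
    have hM : 0 ≤ M := hw0.trans hwM
    calc D w * ρ w ^ 2 ≤ D w * (M * ρ w) := by
          refine mul_le_mul_of_nonneg_left ?_ (hDnn w hw)
          rw [sq]
          exact mul_le_mul_of_nonneg_right hwM hw0
      _ ≤ (γ / 2 * ∫ x, min w x * ρ x ∂μ) * (M * ρ w) :=
          mul_le_mul_of_nonneg_right (hDle w hw) (mul_nonneg hM hw0)
      _ = γ / 2 * M * ∫ x, min w x * ρ w * ρ x ∂μ := by
          rw [hpull]
          ring
  rw [integral_const_mul] at hle
  rw [hG]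
  linarith
end

section
/- Let γ > 0, χ ≥ 0, and c₀ > 0, and define ρ_∞ : (0,∞) → (0,∞) by ρ_∞(w) = c₀ w^{−(2 + 2χ/γ)} exp(−2χ/(γ w)). Then ρ_∞ satisfies the small-wealth equilibrium equation of the modified Yard-Sale Model with taxation: for all w > 0, χ (1 − w) ρ_∞(w) = d/dw [ (γ/2) w² ρ_∞(w) ]. -/
open Set

/-- **Small-wealth equilibrium of the taxed modified Yard-Sale Model.**
For `γ > 0`, `χ ≥ 0`, `c₀ > 0`, the profile
`ρ_∞(w) = c₀ w^{−(2 + 2χ/γ)} exp(−2χ/(γw))` satisfies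
`χ(1 − w) ρ_∞(w) = d/dw [(γ/2) w² ρ_∞(w)]` for all `w > 0`. -/
theorem small_wealth_equilibrium
    (γ χ c₀ : ℝ) (hγ : 0 < γ) (hχ : 0 ≤ χ) (hc₀ : 0 < c₀)
    (ρ : ℝ → ℝ)
    (hρ : ∀ w ∈ Ioi (0 : ℝ),
      ρ w = c₀ * w ^ (-(2 + 2 * χ / γ)) * Real.exp (-(2 * χ) / (γ * w))) :
    ∀ w ∈ Ioi (0 : ℝ),
      HasDerivAt (fun v => γ / 2 * v ^ 2 * ρ v) (χ * (1 - w) * ρ w) w := by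
  intro w hw
  have hw0 : w ≠ 0 := ne_of_gt hw
  have hpow := Real.hasDerivAt_rpow_const (p := -(2 + 2 * χ / γ)) (Or.inl hw0)
  have hexp := ((hasDerivAt_const w (-(2 * χ))).div ((hasDerivAt_id w).const_mul γ)
    (mul_ne_zero hγ.ne' hw0)).exp
  have hprofile := (((hasDerivAt_id w).pow 2).const_mul (γ / 2)).mul
    ((hpow.const_mul c₀).mul hexp)
  refine (hprofile.congr_deriv ?_).congr_of_eventuallyEq ?_
  · rw [hρ w hw, Real.rpow_sub_one hw0]
    simp only [Pi.mul_apply, Pi.div_apply, Pi.pow_apply, id]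
    field_simp
    ring
  · filter_upwards [Ioi_mem_nhds hw] with v hv
    rw [hρ v hv]
    rfl
end
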